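/- Let G be a topologically closed subgroup of GL_m(ℂ). Then G has cofibrantly commuting elements: for every n ≥ 1 and every 1 ≤ r ≤ n such that S_n(r, G) is nonempty, the pair (S_n(r−1, G), S_n(r, G)) is an NDR-pair (where S_n(0, G) is understood to be Hom(ℤ^n, G)); in particular the inclusion S_n(r, G) → S_n(r−1, G) is a cofibration with cofiber the quotient S_n(r−1, G)/S_n(r, G). -/

import Mathlib

/-- `(h, u)` represents `(X, A)` as an NDR-pair (Steenrod): `u : X → [0,1]` and
`h : [0,1] × X → X` are continuous, `A = u⁻¹(0)`, `h(0, x) = x`, `h(t, a) = a` for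
`a ∈ A`, and `h(1, x) ∈ A` whenever `u(x) < 1`. -/
def RepresentsNDR {X : Type*} [TopologicalSpace X] (A : Set X)
    (h : unitInterval × X → X) (u : X → ℝ) : Prop :=
  Continuous u ∧ Continuous h ∧ (∀ x, u x ∈ unitInterval) ∧
    A = u ⁻¹' {0} ∧
    (∀ x, h (0, x) = x) ∧
    (∀ t : unitInterval, ∀ a ∈ A, h (t, a) = a) ∧
    (∀ x, u x < 1 → h (1, x) ∈ A)

/-- `S_n(r, G) = Hom(ℤⁿ, G) ∩ F_r Gⁿ`: commuting `n`-tuples with at least `r` coordinates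
equal to the identity.  For `r = 0` this is `Hom(ℤⁿ, G)` itself. -/
def Sset (G : Type*) [Group G] (n r : ℕ) : Set (Fin n → G) :=
  {x | (∀ i j, x i * x j = x j * x i) ∧
    ∃ s : Finset (Fin n), r ≤ s.card ∧ ∀ j ∈ s, x j = 1}

instance (G : Type*) [Group G] [TopologicalSpace G] (n r : ℕ) :
    TopologicalSpace (Sset G n r) :=
  inferInstanceAs (TopologicalSpace (Subtype _))

open Filter Topology NormedSpace

section HomotopyExtension

/-- A homotopy may be reparametrised by a time function that is discontinuous at points which
the homotopy keeps fixed. -/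
theorem continuous_homotopy_of_fixed {X Z : Type*} [TopologicalSpace X] [TopologicalSpace Z]
    {h : unitInterval × X → X} (hh : Continuous h) {φ : Z → X} (hφ : Continuous φ)
    {σ : Z → unitInterval}
    (hσ : ∀ z, ContinuousAt σ z ∨ ∀ s, h (s, φ z) = φ z) :
    Continuous fun z => h (σ z, φ z) := by
  rw [continuous_iff_continuousAt]
  intro z
  rcases hσ z with hz | hz
  · exact hh.continuousAt.comp (hz.prodMk hφ.continuousAt)
  · intro V hV
    beta_reduce at hV
    rw [hz] at hV
    have hV' : ∀ᶠ x in 𝓝 (φ z), ∀ s ∈ (Set.univ : Set unitInterval), h (s, x) ∈ V := by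
      refine isCompact_univ.eventually_forall_of_forall_eventually fun s _ => ?_
      have hc : Tendsto (fun q : X × unitInterval => h (q.2, q.1)) (𝓝 (φ z, s)) (𝓝 (φ z)) := by
        have := (hh.comp continuous_swap).tendsto (φ z, s)
        simpa only [Function.comp_def, Prod.swap_prod_mk, Prod.swap, hz s] using this
      exact hc.eventually hV
    rw [mem_map]
    filter_upwards [hφ.continuousAt.eventually hV'] with w hw using hw _ trivial

/-- The ratio `a / b` truncated to the unit interval; it is `0` when `b = 0`. -/
noncomputable def truncatedRatio (a b : ℝ) : unitInterval :=
  Set.projIcc 0 1 zero_le_one (a / b)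

theorem truncatedRatio_zero_left (b : ℝ) : truncatedRatio 0 b = 0 := by
  simp [truncatedRatio]

theorem truncatedRatio_eq_one {a b : ℝ} (hb : 0 < b) (hab : b ≤ a) : truncatedRatio a b = 1 :=
  Set.projIcc_of_right_le _ ((one_le_div hb).2 hab)

theorem ContinuousAt.truncatedRatio {Z : Type*} [TopologicalSpace Z] {a b : Z → ℝ} {z : Z}
    (ha : ContinuousAt a z) (hb : ContinuousAt b z) (h0 : b z ≠ 0) :
    ContinuousAt (fun z => truncatedRatio (a z) (b z)) z :=
  continuous_projIcc.continuousAt.comp (ha.div hb h0)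

/-- An NDR-pair has the homotopy extension property. -/
theorem RepresentsNDR.homotopy_extension {X Y : Type*} [TopologicalSpace X] [TopologicalSpace Y]
    {A : Set X} {h : unitInterval × X → X} {u : X → ℝ} (hu : RepresentsNDR A h u)
    {f : X → Y} (hf : Continuous f) {K : unitInterval × A → Y} (hK : Continuous K)
    (hKf : ∀ a, K (0, a) = f a) :
    ∃ K' : unitInterval × X → Y, Continuous K' ∧ (∀ x, K' (0, x) = f x) ∧
      ∀ (t : unitInterval) (a : A), K' (t, (a : X)) = K (t, a) := by
  classical
  obtain ⟨uc, hc, uI, hA, h0, hfix, h1⟩ := hu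
  have mem_iff : ∀ x, x ∈ A ↔ u x = 0 := fun x => by rw [hA]; rfl
  have hAc : IsClosed A := by rw [hA]; exact isClosed_singleton.preimage uc
  let glue : unitInterval × X → Y := fun p =>
    if hp : p.2 ∈ A then K (p.1, ⟨p.2, hp⟩) else f p.2
  have glue_A : ∀ t (a : A), glue (t, a) = K (t, a) := fun t a => by simp [glue]
  have glue_zero : ∀ x, glue (0, x) = f x := fun x => by
    by_cases hx : x ∈ A
    · simpa [glue, hx] using hKf ⟨x, hx⟩
    · simp [glue, hx]
  have glue_cont : ContinuousOn glue ({p | p.1 = 0} ∪ {p | p.2 ∈ A}) := by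
    refine ContinuousOn.union_of_isClosed ?_ ?_
      (isClosed_singleton.preimage continuous_fst) (hAc.preimage continuous_snd)
    · refine (hf.comp continuous_snd).continuousOn.congr ?_
      rintro ⟨t, x⟩ (rfl : t = 0)
      exact glue_zero x
    · rw [continuousOn_iff_continuous_domRestrict]
      have : Continuous fun p : {p : unitInterval × X | p.2 ∈ A} =>
          K (p.1.1, ⟨p.1.2, p.2⟩) := by fun_prop
      refine this.congr fun p => ?_
      exact (glue_A p.1.1 ⟨p.1.2, p.2⟩).symm
  let retr : unitInterval × X → unitInterval × X := fun p =>
    (Set.projIcc 0 1 zero_le_one (p.1 - 2 * u p.2),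
      h (truncatedRatio p.1 (2 * u p.2), p.2))
  have retr_cont : Continuous retr := by
    refine (continuous_projIcc.comp (by fun_prop)).prodMk
      (continuous_homotopy_of_fixed hc continuous_snd fun z => ?_)
    by_cases hz : u z.2 = 0
    · exact Or.inr fun s => hfix s _ ((mem_iff _).2 hz)
    · exact Or.inl (ContinuousAt.truncatedRatio (by fun_prop) (by fun_prop) (by simpa using hz))
  have retr_mem : ∀ p, retr p ∈ ({p | p.1 = 0} ∪ {p | p.2 ∈ A} : Set (unitInterval × X)) := by
    rintro ⟨t, x⟩
    by_cases hx : x ∈ A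
    · right
      change h (_, x) ∈ A
      rwa [hfix _ x hx]
    · have hpos : 0 < u x := lt_of_le_of_ne (uI x).1 fun e => hx ((mem_iff x).2 e.symm)
      rcases le_total (t : ℝ) (2 * u x) with ht | ht
      · left
        exact Set.projIcc_of_le_left zero_le_one (by linarith)
      · right
        change h (truncatedRatio t (2 * u x), x) ∈ A
        rw [truncatedRatio_eq_one (by linarith) ht]
        exact h1 x (by linarith [t.2.2])
  refine ⟨glue ∘ retr, glue_cont.comp_continuous retr_cont retr_mem, fun x => ?_, fun t a => ?_⟩
  · have : retr (0, x) = (0, x) := by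
      refine Prod.ext (Set.projIcc_of_le_left zero_le_one ?_) ?_
      · simpa using (uI x).1
      · simp [retr, truncatedRatio_zero_left, h0]
    rw [Function.comp_apply, this, glue_zero]
  · have : retr (t, (a : X)) = (t, (a : X)) := by
      refine Prod.ext ?_ (hfix _ _ a.2)
      simp [retr, (mem_iff _).1 a.2]
    rw [Function.comp_apply, this, glue_A]

end HomotopyExtension

section CommutingContraction

/-- A representation `(homotopy, gauge)` of `(G, {1})` as an NDR-pair whose homotopy preserves
commutativity of pairs of elements. -/
structure CommutingContraction (G : Type*) [Group G] [TopologicalSpace G] where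
  gauge : G → unitInterval
  homotopy : unitInterval × G → G
  continuous_gauge : Continuous gauge
  continuous_homotopy : Continuous homotopy
  gauge_eq_zero_iff : ∀ g, gauge g = 0 ↔ g = 1
  homotopy_zero : ∀ g, homotopy (0, g) = g
  homotopy_apply_one : ∀ t, homotopy (t, 1) = 1
  homotopy_one : ∀ g, gauge g < 1 → homotopy (1, g) = 1
  commute : ∀ g g', Commute g g' → ∀ s t, Commute (homotopy (s, g)) (homotopy (t, g'))

namespace CommutingContraction

variable {G : Type*} [Group G] [TopologicalSpace G] (C : CommutingContraction G) {n : ℕ}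

/-- The `r`-th smallest of the gauges of the coordinates of a tuple. -/
noncomputable def orderGauge (r : ℕ) (x : Fin n → G) : unitInterval :=
  (Finset.univ.powersetCard r).inf fun s => s.sup fun i => C.gauge (x i)

theorem continuous_orderGauge (r : ℕ) :
    Continuous (C.orderGauge r : (Fin n → G) → unitInterval) :=
  Continuous.finset_inf_apply fun _ _ => Continuous.finset_sup_apply fun i _ =>
    C.continuous_gauge.comp (continuous_apply i)

theorem exists_gauge_le_orderGauge {r : ℕ} (hr : r ≤ n) (x : Fin n → G) :
    ∃ s : Finset (Fin n), s.card = r ∧ ∀ i ∈ s, C.gauge (x i) ≤ C.orderGauge r x := by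
  obtain ⟨s, hs, h⟩ := Finset.exists_mem_eq_inf (Finset.univ.powersetCard r)
    (Finset.powersetCard_nonempty.2 (by simpa using hr))
    (fun s => s.sup fun i => C.gauge (x i))
  refine ⟨s, (Finset.mem_powersetCard.1 hs).2, fun i hi => ?_⟩
  rw [orderGauge, h]
  exact Finset.le_sup (f := fun i => C.gauge (x i)) hi

theorem orderGauge_eq_zero_iff {r : ℕ} (hr : r ≤ n) (x : Fin n → G) :
    C.orderGauge r x = 0 ↔ ∃ s : Finset (Fin n), r ≤ s.card ∧ ∀ j ∈ s, x j = 1 := by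
  constructor
  · intro h
    obtain ⟨s, hs, hle⟩ := C.exists_gauge_le_orderGauge hr x
    refine ⟨s, hs.ge, fun j hj => (C.gauge_eq_zero_iff _).1 (le_bot_iff.1 ?_)⟩
    exact (hle j hj).trans h.le
  · rintro ⟨s, hs, h⟩
    obtain ⟨s', hs', hcard⟩ := Finset.exists_subset_card_eq hs
    refine le_bot_iff.1 ((Finset.inf_le (b := s')
      (Finset.mem_powersetCard.2 ⟨Finset.subset_univ _, hcard⟩)).trans (Finset.sup_le ?_))
    exact fun i hi => ((C.gauge_eq_zero_iff _).2 (h i (hs' hi))).le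

/-- Contracts the coordinates of a tuple with the `r` smallest gauges, slowing down the others
so that tuples with `r` trivial coordinates do not move. -/
noncomputable def tupleHomotopy (r : ℕ) (p : unitInterval × (Fin n → G)) : Fin n → G := fun i =>
  C.homotopy (p.1 * truncatedRatio (C.orderGauge r p.2) (C.gauge (p.2 i)), p.2 i)

theorem continuous_tupleHomotopy (r : ℕ) :
    Continuous (C.tupleHomotopy r : unitInterval × (Fin n → G) → Fin n → G) := by
  refine continuous_pi fun i => ?_
  have hg := C.continuous_gauge
  have ho := C.continuous_orderGauge (n := n) r
  refine continuous_homotopy_of_fixed C.continuous_homotopy (by fun_prop) fun z => ?_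
  by_cases hz : C.gauge (z.2 i) = 0
  · exact Or.inr fun s => by rw [(C.gauge_eq_zero_iff _).1 hz, C.homotopy_apply_one]
  · refine Or.inl (continuousAt_fst.mul (ContinuousAt.truncatedRatio ?_ ?_ ?_))
    · exact (continuous_subtype_val.comp (ho.comp continuous_snd)).continuousAt
    · exact (continuous_subtype_val.comp
        (hg.comp ((continuous_apply i).comp continuous_snd))).continuousAt
    · simpa using hz

theorem tupleHomotopy_mem {r q : ℕ} {x : Fin n → G} (hx : x ∈ Sset G n q) (t : unitInterval) :
    C.tupleHomotopy r (t, x) ∈ Sset G n q := by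
  obtain ⟨hcomm, s, hs, h1⟩ := hx
  refine ⟨fun i j => C.commute _ _ (hcomm i j) _ _, s, hs, fun j hj => ?_⟩
  simp only [tupleHomotopy, h1 j hj, C.homotopy_apply_one]

theorem representsNDR {r q : ℕ} (hr : r ≤ n) :
    RepresentsNDR {x : Sset G n q | (x : Fin n → G) ∈ Sset G n r}
      (fun p => ⟨C.tupleHomotopy r (p.1, p.2), C.tupleHomotopy_mem p.2.2 p.1⟩)
      (fun x => C.orderGauge r (x : Fin n → G)) := by
  have mem_iff : ∀ x : Sset G n q, (x : Fin n → G) ∈ Sset G n r ↔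
      C.orderGauge r (x : Fin n → G) = 0 := fun x =>
    ⟨fun h => (C.orderGauge_eq_zero_iff hr _).2 h.2,
      fun h => ⟨x.2.1, (C.orderGauge_eq_zero_iff hr _).1 h⟩⟩
  have hval : Continuous (Subtype.val : Sset G n q → Fin n → G) := continuous_subtype_val
  refine ⟨?_, ?_, fun x => (C.orderGauge r x.1).2, ?_, fun x => ?_, fun t a ha => ?_,
    fun x hx => ?_⟩
  · exact continuous_subtype_val.comp ((C.continuous_orderGauge r).comp hval)
  · refine Continuous.subtype_mk ((C.continuous_tupleHomotopy r).comp ?_) _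
    exact continuous_fst.prodMk (hval.comp continuous_snd)
  · ext x
    simpa using mem_iff x
  · refine Subtype.ext (funext fun i => ?_)
    simp [tupleHomotopy, C.homotopy_zero]
  · refine Subtype.ext (funext fun i => ?_)
    simp [tupleHomotopy, (mem_iff a).1 ha, truncatedRatio_zero_left, C.homotopy_zero]
  · obtain ⟨s, hs, hle⟩ := C.exists_gauge_le_orderGauge hr x.1
    refine ⟨(C.tupleHomotopy_mem x.2 1).1, s, hs.ge, fun j hj => ?_⟩
    change C.homotopy (1 * truncatedRatio _ _, x.1 j) = 1
    by_cases h0 : C.gauge (x.1 j) = 0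
    · rw [(C.gauge_eq_zero_iff _).1 h0, C.homotopy_apply_one]
    · rw [truncatedRatio_eq_one (unitInterval.pos_iff_ne_zero.2 h0) (hle j hj), one_mul]
      exact C.homotopy_one _ ((hle j hj).trans_lt hx)

end CommutingContraction

end CommutingContraction

section ClosedSubgroup

section ExpUnit

variable {A : Type*} [NormedRing A] [NormedAlgebra ℚ A] [CompleteSpace A]

/-- The exponential as a map into the group of units. -/
noncomputable def expUnit (X : A) : Aˣ where
  val := exp X
  inv := exp (-X)
  val_inv := by rw [← exp_add_of_commute (Commute.refl X).neg_right, add_neg_cancel, exp_zero]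
  inv_val := by rw [← exp_add_of_commute (Commute.refl X).neg_left, neg_add_cancel, exp_zero]

@[simp]
theorem val_expUnit (X : A) : (expUnit X : A) = exp X := rfl

theorem continuous_expUnit : Continuous (expUnit : A → Aˣ) :=
  Units.continuous_iff.2 ⟨exp_continuous, exp_continuous.comp continuous_neg⟩

@[simp]
theorem expUnit_zero : expUnit (0 : A) = 1 := Units.ext (by simp)

theorem expUnit_neg (X : A) : expUnit (-X) = (expUnit X)⁻¹ := Units.ext rfl

theorem expUnit_zsmul (k : ℤ) (X : A) : expUnit (k • X) = expUnit X ^ k := by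
  have hn : ∀ n : ℕ, expUnit (n • X) = expUnit X ^ n := fun n => Units.ext (exp_nsmul n X)
  obtain ⟨n, rfl | rfl⟩ := k.eq_nat_or_neg
  · simpa using hn n
  · simpa [expUnit_neg] using hn n

end ExpUnit

section ExpChart

variable {A : Type*} [NormedRing A] [NormedAlgebra ℝ A] [CompleteSpace A]

theorem hasStrictFDerivAt_exp_zero_refl :
    HasStrictFDerivAt (exp : A → A) (ContinuousLinearEquiv.refl ℝ A : A →L[ℝ] A) 0 :=
  hasStrictFDerivAt_exp_zero

variable (A) in
/-- The exponential as a local homeomorphism near `0`; its inverse is the logarithm. -/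
noncomputable def expChart : OpenPartialHomeomorph A A :=
  (hasStrictFDerivAt_exp_zero_refl (A := A)).toOpenPartialHomeomorph exp

@[simp]
theorem expChart_apply (X : A) : expChart A X = exp X := rfl

theorem zero_mem_expChart_source : (0 : A) ∈ (expChart A).source :=
  hasStrictFDerivAt_exp_zero_refl.mem_toOpenPartialHomeomorph_source

theorem one_mem_expChart_target : (1 : A) ∈ (expChart A).target := by
  simpa using (expChart A).map_source zero_mem_expChart_source

theorem expChart_symm_one : (expChart A).symm 1 = 0 := by
  simpa using (expChart A).left_inv zero_mem_expChart_source

end ExpChart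

variable {A : Type*} [NormedRing A] [NormedAlgebra ℚ A] [NormedAlgebra ℝ A] [CompleteSpace A]

/-- An element commuting with the exponential of a small `X` commutes with `X`. -/
theorem commute_of_commute_exp {X v : A} (hX : X ∈ (expChart A).source)
    (h : Commute v (exp X)) : Commute v X := by
  let w : ℝ → A := fun s => 1 + s • v
  have hw : Tendsto w (𝓝 0) (𝓝 ((1 : Aˣ) : A)) := by
    have : Continuous w := by fun_prop
    simpa [w] using this.tendsto 0
  have hconj : Tendsto (fun s => w s * X * Ring.inverse (w s)) (𝓝 0) (𝓝 X) := by
    simpa using (hw.mul_const X).mul ((NormedRing.inverse_continuousAt (1 : Aˣ)).tendsto.comp hw)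
  have hev := (hw.eventually (Units.nhds (1 : Aˣ))).and
    (hconj.eventually ((expChart A).open_source.mem_nhds hX))
  obtain ⟨s, ⟨⟨u, hu⟩, hs⟩, hs0⟩ :=
    ((hev.filter_mono nhdsWithin_le_nhds).and
      (self_mem_nhdsWithin : ∀ᶠ s : ℝ in 𝓝[≠] 0, s ≠ 0)).exists
  rw [← hu, Ring.inverse_unit] at hs
  have hucomm : Commute (u : A) (exp X) := by
    rw [hu]
    exact (Commute.one_left _).add_left (h.smul_left s)
  have heq : (u * X * ↑u⁻¹ : A) = X := by
    refine (expChart A).injOn hs hX ?_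
    rw [expChart_apply, expChart_apply, exp_units_conj, hucomm.eq, Units.mul_inv_cancel_right]
  have huX : Commute (u : A) X := (Units.mul_inv_eq_iff_eq_mul u).1 heq
  have hsv : Commute (s • v) X := by
    have := huX.sub_left (Commute.one_left X)
    rwa [hu, add_sub_cancel_left] at this
  simpa [smul_smul, inv_mul_cancel₀ hs0] using hsv.smul_left s⁻¹

variable {H : Subgroup Aˣ}

/-- If small elements `X` with `exp X` in a closed subgroup are rescaled to converge to `Y`, then
`exp Y` lies in the subgroup. -/
theorem expUnit_mem_of_tendsto (hH : IsClosed (H : Set Aˣ)) {ι : Type*} {l : Filter ι} [NeBot l]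
    {X : ι → A} {c : ι → ℝ} {Y : A} (hX : Tendsto X l (𝓝 0))
    (hcX : Tendsto (fun i => c i • X i) l (𝓝 Y)) (hXH : ∀ᶠ i in l, expUnit (X i) ∈ H) :
    expUnit Y ∈ H := by
  have hfract : Tendsto (fun i => Int.fract (c i) • X i) l (𝓝 0) := by
    refine squeeze_zero_norm (fun i => ?_) (tendsto_zero_iff_norm_tendsto_zero.1 hX)
    rw [norm_smul, Real.norm_of_nonneg (Int.fract_nonneg _)]
    exact mul_le_of_le_one_left (norm_nonneg _) (Int.fract_lt_one _).le
  have hfloor : Tendsto (fun i => ⌊c i⌋ • X i) l (𝓝 Y) := by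
    refine ((hcX.sub hfract).congr fun i => ?_).trans_eq (by rw [sub_zero])
    rw [← sub_smul, Int.self_sub_fract, Int.cast_smul_eq_zsmul]
  refine hH.mem_of_tendsto ((continuous_expUnit.tendsto Y).comp hfloor) (hXH.mono fun i hi => ?_)
  rw [Function.comp_apply, expUnit_zsmul]
  exact H.zpow_mem hi _

/-- The Lie algebra of a closed subgroup of the group of units of a Banach algebra. -/
def tangentSubmodule (H : Subgroup Aˣ) (hH : IsClosed (H : Set Aˣ)) : Submodule ℝ A where
  carrier := {X | ∀ t : ℝ, expUnit (t • X) ∈ H}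
  zero_mem' t := by simp [H.one_mem]
  smul_mem' c X hX t := by simpa [smul_smul] using hX (t * c)
  add_mem' {X Y} hX hY t := by
    let f : ℝ → A := fun s => (expChart A).symm (exp (s • X) * exp (s • Y))
    have hprod : HasDerivAt (fun s : ℝ => exp (s • X) * exp (s • Y)) (X + Y) 0 := by
      have := (hasDerivAt_exp_smul_const X (0 : ℝ)).fun_mul (hasDerivAt_exp_smul_const Y (0 : ℝ))
      simpa using this
    have hlog : HasFDerivAt (expChart A).symm (ContinuousLinearMap.id ℝ A)
        (exp ((0 : ℝ) • X) * exp ((0 : ℝ) • Y)) := by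
      have := (hasStrictFDerivAt_exp_zero_refl (A := A)).to_localInverse.hasFDerivAt
      simpa only [zero_smul, exp_zero, mul_one] using! this
    have hf : HasDerivAt f (X + Y) 0 := by
      simpa using! hlog.comp_hasDerivAt (0 : ℝ) hprod
    have hf0 : f 0 = 0 := by simp [f, expChart_symm_one]
    have hslope : Tendsto (fun s : ℝ => (t * s⁻¹) • f s) (𝓝[≠] 0) (𝓝 (t • (X + Y))) := by
      have := hf.tendsto_slope_zero.const_smul t
      simpa [hf0, smul_smul] using this
    have hfz : Tendsto f (𝓝[≠] 0) (𝓝 0) := by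
      have := hf.continuousAt.tendsto
      rw [hf0] at this
      exact this.mono_left nhdsWithin_le_nhds
    refine expUnit_mem_of_tendsto hH hfz hslope ?_
    have htarget : ∀ᶠ s : ℝ in 𝓝 0, exp (s • X) * exp (s • Y) ∈ (expChart A).target :=
      hprod.continuousAt.eventually ((expChart A).open_target.mem_nhds
        (by simpa using one_mem_expChart_target))
    filter_upwards [htarget.filter_mono nhdsWithin_le_nhds] with s hs
    have : expUnit (f s) = expUnit (s • X) * expUnit (s • Y) :=
      Units.ext ((expChart A).right_inv hs)
    rw [this]
    exact H.mul_mem (hX s) (hY s)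

/-- Cartan's closed subgroup theorem: the logarithms of the elements of a closed subgroup near `1`
lie in its Lie algebra. -/
theorem eventually_log_mem_tangentSubmodule [FiniteDimensional ℝ A]
    (hH : IsClosed (H : Set Aˣ)) :
    ∀ᶠ a : A in 𝓝 1, ∀ g ∈ H, (g : A) = a → (expChart A).symm a ∈ tangentSubmodule H hH := by
  let T := tangentSubmodule H hH
  obtain ⟨S, hTS⟩ := T.exists_isCompl
  let P : A →L[ℝ] A := LinearMap.toContinuousLinearMap (T.projection S hTS)
  let Q : A →L[ℝ] A := LinearMap.toContinuousLinearMap (S.projection T hTS.symm)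
  have hP : ∀ Z, P Z ∈ T := T.projection_apply_mem hTS
  have hQ : ∀ Z, Q Z ∈ S := S.projection_apply_mem hTS.symm
  have hPQ : ∀ Z, P Z + Q Z = Z := Submodule.projection_add_projection_eq_self hTS
  have hΦ : HasStrictFDerivAt (fun Z => exp (P Z) * exp (Q Z))
      (ContinuousLinearEquiv.refl ℝ A : A →L[ℝ] A) 0 := by
    have hexp : ∀ R : A →L[ℝ] A, HasStrictFDerivAt (fun Z => exp (R Z)) R 0 := fun R => by
      have h0 : HasStrictFDerivAt (exp : A → A) (ContinuousLinearMap.id ℝ A) (R 0) := by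
        rw [map_zero]; exact hasStrictFDerivAt_exp_zero
      simpa using h0.comp 0 R.hasStrictFDerivAt
    refine ((hexp P).mul' (hexp Q)).congr_fderiv ?_
    ext Z
    simpa using (add_comm _ _).trans (hPQ Z)
  let Ψ := hΦ.localInverse _ _ _
  have hΨ : Tendsto Ψ (𝓝 1) (𝓝 0) := by simpa using hΦ.localInverse_tendsto
  have hright : ∀ᶠ a in 𝓝 (1 : A), exp (P (Ψ a)) * exp (Q (Ψ a)) = a := by
    simpa using hΦ.eventually_right_inverse
  have hQΨ : Tendsto (fun a => Q (Ψ a)) (𝓝 1) (𝓝 0) := by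
    simpa using! (Q.continuous.tendsto 0).comp hΨ
  have hPΨ : Tendsto (fun a => P (Ψ a)) (𝓝 1) (𝓝 0) := by
    simpa using! (P.continuous.tendsto 0).comp hΨ
  have hQH : ∀ᶠ a in 𝓝 (1 : A), ∀ g ∈ H, (g : A) = a → expUnit (Q (Ψ a)) ∈ H := by
    filter_upwards [hright] with a ha g hg hga
    have : expUnit (Q (Ψ a)) = (expUnit (P (Ψ a)))⁻¹ * g := by
      rw [eq_inv_mul_iff_mul_eq]
      exact Units.ext (ha.trans hga.symm)
    rw [this]
    exact H.mul_mem (H.inv_mem (by simpa using hP (Ψ a) 1)) hg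
  have hQ0 : ∀ᶠ a in 𝓝 (1 : A), ∀ g ∈ H, (g : A) = a → Q (Ψ a) = 0 := by
    by_contra hcon
    rw [not_eventually] at hcon
    let l : Filter A := 𝓝 1 ⊓ 𝓟 {a | ¬ ∀ g ∈ H, (g : A) = a → Q (Ψ a) = 0}
    have : NeBot l := frequently_iff_neBot.1 hcon
    let U := Ultrafilter.of l
    have hUl : (U : Filter A) ≤ l := Ultrafilter.of_le l
    have hU1 : (U : Filter A) ≤ 𝓝 1 := hUl.trans inf_le_left
    have hU2 : ∀ᶠ a in (U : Filter A), ¬ ∀ g ∈ H, (g : A) = a → Q (Ψ a) = 0 :=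
      hUl.trans inf_le_right (mem_principal_self _)
    let d : A → A := fun a => ‖Q (Ψ a)‖⁻¹ • Q (Ψ a)
    have hd : ∀ᶠ a in (U : Filter A), d a ∈ Metric.sphere (0 : A) 1 := by
      filter_upwards [hU2] with a ha
      push Not at ha
      obtain ⟨-, -, -, hne⟩ := ha
      simp [d, norm_smul, hne]
    have : ProperSpace A := FiniteDimensional.proper ℝ A
    obtain ⟨Y, hY, hdY⟩ := (isCompact_sphere (0 : A) 1).ultrafilter_le_nhds (U.map d)
      (le_principal_iff.2 hd)
    have hdY' : Tendsto d U (𝓝 Y) := hdY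
    have hYT : Y ∈ T := fun t => by
      refine expUnit_mem_of_tendsto (l := (U : Filter A)) (c := fun a => t * ‖Q (Ψ a)‖⁻¹)
        hH (hQΨ.mono_left hU1) ?_ ?_
      · simpa [d, smul_smul] using hdY'.const_smul t
      · filter_upwards [hU2, hQH.filter_mono hU1] with a ha ha'
        push Not at ha
        obtain ⟨g, hg, hga, -⟩ := ha
        exact ha' g hg hga
    have hYS : Y ∈ S := by
      refine S.closed_of_finiteDimensional.mem_of_tendsto hdY' (Eventually.of_forall fun a => ?_)
      exact S.smul_mem _ (hQ _)
    have hY0 : Y = 0 := by simpa using hTS.disjoint.le_bot ⟨hYT, hYS⟩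
    simp [hY0] at hY
  filter_upwards [hQ0, hright, hPΨ.eventually ((expChart A).open_source.mem_nhds
    zero_mem_expChart_source)] with a h0 hr hs g hg hga
  rw [h0 g hg hga, exp_zero, mul_one] at hr
  have : (expChart A).symm a = P (Ψ a) := by
    conv_lhs => rw [← hr]
    exact (expChart A).left_inv hs
  rw [this]
  exact hP _

/-- A closed subgroup of the group of units of a finite-dimensional real algebra contracts near `1`
along one-parameter subgroups, and this contraction preserves commutativity. -/
theorem nonempty_commutingContraction [FiniteDimensional ℝ A] (hH : IsClosed (H : Set Aˣ)) :
    Nonempty (CommutingContraction H) := by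
  obtain ⟨δ, hδ, hball⟩ := Metric.eventually_nhds_iff_ball.1
    (((expChart A).open_target.eventually_mem one_mem_expChart_target).and
      (eventually_log_mem_tangentSubmodule hH))
  let D : A → ℝ := fun a => 4 * ‖a - 1‖ / δ
  have hD : Continuous D := by fun_prop
  have mem_ball : ∀ a, D a < 4 → a ∈ Metric.ball 1 δ := fun a ha => by
    rw [mem_ball_iff_norm]
    have : 4 * ‖a - 1‖ < 4 * δ := (div_lt_iff₀ hδ).1 ha
    linarith
  have hD1 : D 1 = 0 := by simp [D]
  let c : A → unitInterval := fun a => Set.projIcc 0 1 zero_le_one (2 - D a)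
  have hc : Continuous c := continuous_projIcc.comp (by fun_prop)
  have hc0 : ∀ a, 2 ≤ D a → c a = 0 := fun a ha =>
    Set.projIcc_of_le_left zero_le_one (by linarith)
  have hc1 : ∀ a, D a ≤ 1 → c a = 1 := fun a ha =>
    Set.projIcc_of_right_le zero_le_one (by linarith)
  let L : A → A := fun a => (c a : ℝ) • (expChart A).symm a
  have hL0 : ∀ a, 2 ≤ D a → L a = 0 := fun a ha => by simp [L, hc0 a ha]
  have hL1 : L 1 = 0 := by simp [L, expChart_symm_one]
  have hL : Continuous L := by
    rw [continuous_iff_continuousAt]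
    intro a
    rcases lt_or_ge (D a) 4 with ha | ha
    · exact (continuous_subtype_val.comp hc).continuousAt.smul
        ((expChart A).continuousAt_symm (hball a (mem_ball a ha)).1)
    · refine (continuousAt_const (y := (0 : A))).congr ?_
      filter_upwards [hD.continuousAt.eventually (lt_mem_nhds (by linarith : 2 < D a))] with b hb
      exact (hL0 b hb.le).symm
  have hLH : ∀ g ∈ H, ∀ s : ℝ, expUnit (s • L g) ∈ H := fun g hg s => by
    rcases lt_or_ge (D g) 4 with ha | ha
    · simpa [L, smul_smul] using (hball g (mem_ball g ha)).2 g hg rfl (s * c g)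
    · simp [hL0 g (by linarith), H.one_mem]
  have hLcomm : ∀ a v : A, Commute v a → Commute v (L a) := fun a v hv => by
    rcases lt_or_ge (D a) 4 with ha | ha
    · have ht := (hball a (mem_ball a ha)).1
      refine (commute_of_commute_exp ((expChart A).map_target ht) ?_).smul_right _
      rwa [← expChart_apply, (expChart A).right_inv ht]
    · rw [hL0 a (by linarith)]
      exact Commute.zero_right v
  have hval : Continuous fun g : H => ((g : Aˣ) : A) :=
    Units.continuous_val.comp continuous_subtype_val
  refine ⟨{
    gauge := fun g => Set.projIcc 0 1 zero_le_one (D (g : Aˣ))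
    homotopy := fun p => p.2 * ⟨expUnit (-(p.1 : ℝ) • L (p.2 : Aˣ)), hLH _ p.2.2 _⟩
    continuous_gauge := continuous_projIcc.comp (hD.comp hval)
    continuous_homotopy := ?_
    gauge_eq_zero_iff := fun g => ?_
    homotopy_zero := fun g => ?_
    homotopy_apply_one := fun t => ?_
    homotopy_one := fun g hg => ?_
    commute := fun g g' h s t => ?_ }⟩
  · refine continuous_snd.mul (Continuous.subtype_mk (continuous_expUnit.comp ?_) _)
    exact (continuous_subtype_val.comp continuous_fst).neg.smul
      (hL.comp (hval.comp continuous_snd))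
  · change Set.projIcc 0 1 zero_le_one (D (g : Aˣ)) = ⟨0, _⟩ ↔ _
    rw [Set.projIcc_eq_left zero_lt_one]
    constructor
    · intro h
      have : 4 * ‖((g : Aˣ) : A) - 1‖ ≤ 0 := by simpa using (div_le_iff₀ hδ).1 h
      have h0 : ((g : Aˣ) : A) - 1 = 0 := norm_le_zero_iff.1 (by linarith)
      exact Subtype.ext (Units.ext (sub_eq_zero.1 h0))
    · rintro rfl
      exact hD1.le
  · exact Subtype.ext (Units.ext (by simp))
  · exact Subtype.ext (Units.ext (by simp [hL1]))
  · have hlt : D (g : Aˣ) < 1 := by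
      by_contra hge
      rw [Set.projIcc_of_right_le zero_le_one (not_lt.1 hge)] at hg
      exact lt_irrefl _ hg
    have hexp : expUnit (L (g : Aˣ)) = g := Units.ext <| by
      have := (expChart A).right_inv (hball _ (mem_ball (g : Aˣ) (by linarith))).1
      simpa [L, hc1 _ hlt.le] using this
    refine Subtype.ext ?_
    change (g : Aˣ) * expUnit (-((1 : unitInterval) : ℝ) • L (g : Aˣ)) = 1
    rw [Set.Icc.coe_one, neg_one_smul, expUnit_neg, hexp, mul_inv_cancel]
  · have hgg : Commute ((g : Aˣ) : A) ((g' : Aˣ) : A) :=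
      congrArg (fun x : H => ((x : Aˣ) : A)) h
    have h1 := hLcomm _ _ hgg
    have h2 := (hLcomm _ _ hgg.symm).symm
    have h12 := hLcomm _ _ h2
    refine Subtype.ext (Units.ext ?_)
    change Commute (((g : Aˣ) : A) * exp (-(s : ℝ) • L (g : Aˣ)))
      (((g' : Aˣ) : A) * exp (-(t : ℝ) • L (g' : Aˣ)))
    refine Commute.mul_left (hgg.mul_right ?_) (Commute.mul_right ?_ ?_)
    · exact (h1.smul_right _).exp_right
    · exact (h2.smul_left _).exp_left
    · exact ((h12.smul_left _).smul_right _).exp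

end ClosedSubgroup


/-- A topologically closed subgroup `G` of `GL_m(ℂ)` has cofibrantly commuting elements:
for every `n ≥ 1` and `1 ≤ r ≤ n` with `S_n(r, G)` nonempty, the pair
`(S_n(r−1, G), S_n(r, G))` is an NDR-pair; in particular the inclusion
`S_n(r, G) → S_n(r−1, G)` is a cofibration, i.e. it satisfies the homotopy extension
property. -/
theorem closed_subgroup_GL_cofibrantly_commuting
    (m : ℕ) (H : Subgroup (GL (Fin m) ℂ))
    (hH : IsClosed (H : Set (GL (Fin m) ℂ)))
    (n : ℕ) (hn : 1 ≤ n) (r : ℕ) (hr : 1 ≤ r) (hrn : r ≤ n)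
    (hne : (Sset H n r).Nonempty) :
    (∃ (h : unitInterval × (Sset H n (r - 1)) → Sset H n (r - 1))
        (u : Sset H n (r - 1) → ℝ),
      RepresentsNDR {x : Sset H n (r - 1) | (x : Fin n → H) ∈ Sset H n r} h u) ∧
    ∀ (Y : Type*) [TopologicalSpace Y]
      (f : Sset H n (r - 1) → Y) (_ : Continuous f)
      (K : unitInterval × {x : Sset H n (r - 1) | (x : Fin n → H) ∈ Sset H n r} → Y)
      (_ : Continuous K)
      (_ : ∀ a, K (0, a) = f a),
      ∃ K' : unitInterval × (Sset H n (r - 1)) → Y,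
        Continuous K' ∧ (∀ x, K' (0, x) = f x) ∧
        ∀ (t : unitInterval) (a : {x : Sset H n (r - 1) | (x : Fin n → H) ∈ Sset H n r}),
          K' (t, (a : Sset H n (r - 1))) = K (t, a) := by
  have hcontr : Nonempty (CommutingContraction H) := by
    let _ : NormedRing (Matrix (Fin m) (Fin m) ℂ) := Matrix.linftyOpNormedRing
    let _ : NormedAlgebra ℚ (Matrix (Fin m) (Fin m) ℂ) := Matrix.linftyOpNormedAlgebra
    let _ : NormedAlgebra ℝ (Matrix (Fin m) (Fin m) ℂ) := Matrix.linftyOpNormedAlgebra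
    exact nonempty_commutingContraction hH
  obtain ⟨C⟩ := hcontr
  exact ⟨⟨_, _, C.representsNDR hrn⟩, fun _ _ _ hf _ hK hKf =>
    (C.representsNDR hrn).homotopy_extension hf hK hKf⟩
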